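/- Let R be a commutative ring containing ℚ as a subring. The map θ : (x_n)_{n≥1} ↦ (n·x_n)_{n≥1} is a ring isomorphism from the necklace ring Nr(R) onto the aperiodic ring Ap(R), and moreover φ̃ = φ ∘ θ, where φ̃(x)_n = ∑_{d|n} d·x_d and φ(x)_n = ∑_{d|n} x_d. -/

import Mathlib

open Finset

/-- The finite set of ordered pairs `(i, j)` of positive integers with `lcm i j = n`. -/
def lcmPairs (n : ℕ) : Finset (ℕ × ℕ) :=
  (n.divisors ×ˢ n.divisors).filter fun p => Nat.lcm p.1 p.2 = n

/-- Extend a sequence indexed by positive integers to all of `ℕ` by `0`. -/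
def seqExt {R : Type*} [Zero R] (x : ℕ+ → R) : ℕ → R :=
  fun n => if h : 0 < n then x ⟨n, h⟩ else 0

@[simp]
theorem seqExt_coe {R : Type*} [Zero R] (x : ℕ+ → R) (n : ℕ+) : seqExt x n = x n :=
  dif_pos n.pos

theorem seqExt_of_pos {R : Type*} [Zero R] (x : ℕ+ → R) {n : ℕ} (h : 0 < n) :
    seqExt x n = x ⟨n, h⟩ := by
  simp [seqExt, h]

/-- The map `x ↦ (∑_{d ∣ n} x_d)_n`, with inverse given by Möbius inversion. -/
def divisorSumEquiv (R : Type*) [CommRing R] : (ℕ+ → R) ≃ (ℕ+ → R) where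
  toFun x n := ∑ d ∈ (n : ℕ).divisors, seqExt x d
  invFun g n := ∑ p ∈ (n : ℕ).divisorsAntidiagonal,
    (ArithmeticFunction.moebius p.1 : R) * seqExt g p.2
  left_inv x := by
    funext n
    have h := ArithmeticFunction.sum_eq_iff_sum_mul_moebius_eq (f := seqExt x)
      (g := seqExt fun n : ℕ+ => ∑ d ∈ (n : ℕ).divisors, seqExt x d)
    simpa using h.1 (fun m hm => by simp [seqExt_of_pos _ hm]) n n.pos
  right_inv g := by
    funext n
    have h := ArithmeticFunction.sum_eq_iff_sum_mul_moebius_eq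
      (f := seqExt fun n : ℕ+ => ∑ p ∈ (n : ℕ).divisorsAntidiagonal,
        (ArithmeticFunction.moebius p.1 : R) * seqExt g p.2) (g := seqExt g)
    simpa using h.2 (fun m hm => by simp [seqExt_of_pos _ hm]) n n.pos

theorem divisorSumEquiv_apply {R : Type*} [CommRing R] (x : ℕ+ → R) (n : ℕ+) :
    divisorSumEquiv R x n = ∑ d ∈ (n : ℕ).divisors, seqExt x d := rfl

theorem divisorSumEquiv_add {R : Type*} [CommRing R] (x y : ℕ+ → R) :
    divisorSumEquiv R (x + y) = divisorSumEquiv R x + divisorSumEquiv R y := by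
  funext n
  simp only [divisorSumEquiv_apply, Pi.add_apply, ← Finset.sum_add_distrib]
  refine Finset.sum_congr rfl fun d hd => ?_
  simp only [seqExt_of_pos _ (Nat.pos_of_mem_divisors hd)]
  rfl

/-- Summing over all pairs with `lcm` dividing `n` is summing over all pairs of divisors. -/
theorem sum_divisors_sum_lcmPairs {M : Type*} [AddCommMonoid M] (f : ℕ × ℕ → M) (n : ℕ+) :
    ∑ d ∈ (n : ℕ).divisors, ∑ p ∈ lcmPairs d, f p
      = ∑ p ∈ (n : ℕ).divisors ×ˢ (n : ℕ).divisors, f p := by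
  rw [← Finset.sum_fiberwise_of_maps_to (t := (n : ℕ).divisors) (g := fun p : ℕ × ℕ => Nat.lcm p.1 p.2)]
  · refine Finset.sum_congr rfl fun d hd => Finset.sum_congr ?_ fun _ _ => rfl
    have hd0 := (Nat.pos_of_mem_divisors hd).ne'
    have hdn := Nat.dvd_of_mem_divisors hd
    ext ⟨i, j⟩
    simp only [lcmPairs, Finset.mem_filter, Finset.mem_product, Nat.mem_divisors]
    constructor
    · rintro ⟨⟨⟨hi, -⟩, hj, -⟩, h⟩
      exact ⟨⟨⟨hi.trans hdn, n.ne_zero⟩, hj.trans hdn, n.ne_zero⟩, h⟩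
    · rintro ⟨-, h⟩
      exact ⟨⟨⟨h ▸ Nat.dvd_lcm_left i j, hd0⟩, h ▸ Nat.dvd_lcm_right i j, hd0⟩, h⟩
  · intro p hp
    simp only [Finset.mem_product, Nat.mem_divisors] at hp ⊢
    exact ⟨Nat.lcm_dvd hp.1.1 hp.2.1, n.ne_zero⟩

theorem divisorSumEquiv_mul {R : Type*} [CommRing R] (x y : ℕ+ → R) :
    divisorSumEquiv R (fun n => ∑ p ∈ lcmPairs (n : ℕ), seqExt x p.1 * seqExt y p.2)
      = divisorSumEquiv R x * divisorSumEquiv R y := by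
  funext n
  rw [Pi.mul_apply, divisorSumEquiv_apply, divisorSumEquiv_apply, divisorSumEquiv_apply,
    Finset.sum_mul_sum, ← Finset.sum_product', ← sum_divisors_sum_lcmPairs]
  refine Finset.sum_congr rfl fun d hd => ?_
  simp [seqExt_of_pos _ (Nat.pos_of_mem_divisors hd)]

theorem isUnit_natCast_pnat (R : Type*) [CommRing R] [Algebra ℚ R] (n : ℕ+) :
    IsUnit ((n : ℕ) : R) := by
  have h : IsUnit ((n : ℕ) : ℚ) := isUnit_iff_ne_zero.2 (by simp)
  simpa using h.map (algebraMap ℚ R)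

/-- The map `x ↦ (n · x_n)_n`. -/
noncomputable def indexScaleEquiv (R : Type*) [CommRing R] [Algebra ℚ R] :
    (ℕ+ → R) ≃ (ℕ+ → R) :=
  Equiv.piCongrRight fun n => (isUnit_natCast_pnat R n).unit.mulLeft

@[simp]
theorem indexScaleEquiv_apply {R : Type*} [CommRing R] [Algebra ℚ R] (x : ℕ+ → R) (n : ℕ+) :
    indexScaleEquiv R x n = ((n : ℕ) : R) * x n := rfl

theorem seqExt_indexScaleEquiv {R : Type*} [CommRing R] [Algebra ℚ R] (x : ℕ+ → R) (d : ℕ) :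
    seqExt (indexScaleEquiv R x) d = (d : R) * seqExt x d := by
  by_cases h : 0 < d
  · rw [seqExt_of_pos _ h, seqExt_of_pos _ h]
    rfl
  · simp [seqExt, h]

theorem indexScaleEquiv_add {R : Type*} [CommRing R] [Algebra ℚ R] (x y : ℕ+ → R) :
    indexScaleEquiv R (x + y) = indexScaleEquiv R x + indexScaleEquiv R y := by
  funext n
  simp [mul_add]

theorem indexScaleEquiv_mul {R : Type*} [CommRing R] [Algebra ℚ R] (x y : ℕ+ → R) :
    indexScaleEquiv R (fun n => ∑ p ∈ lcmPairs (n : ℕ),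
        (Nat.gcd p.1 p.2 : R) * seqExt x p.1 * seqExt y p.2)
      = fun n : ℕ+ => ∑ p ∈ lcmPairs (n : ℕ),
        seqExt (indexScaleEquiv R x) p.1 * seqExt (indexScaleEquiv R y) p.2 := by
  funext n
  rw [indexScaleEquiv_apply, Finset.mul_sum]
  refine Finset.sum_congr rfl fun p hp => ?_
  have hlcm : Nat.lcm p.1 p.2 = n := (Finset.mem_filter.1 hp).2
  have h : (Nat.gcd p.1 p.2 : R) * ((n : ℕ) : R) = (p.1 : R) * p.2 := by
    rw [← hlcm]
    exact_mod_cast congrArg (Nat.cast : ℕ → R) (Nat.gcd_mul_lcm p.1 p.2)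
  rw [seqExt_indexScaleEquiv, seqExt_indexScaleEquiv]
  linear_combination seqExt x p.1 * seqExt y p.2 * h

/-- For a commutative ring `R` containing `ℚ` as a subring, the map
`θ : (x_n)_{n≥1} ↦ (n·x_n)_{n≥1}` is a ring isomorphism from the necklace ring `Nr(R)`
(componentwise addition, `(x·y)_n = ∑_{lcm(i,j)=n} gcd(i,j)·x_i·y_j`) onto the aperiodic
ring `Ap(R)` (componentwise addition, `(x·y)_n = ∑_{lcm(i,j)=n} x_i·y_j`), and moreover
`φ̃ = φ ∘ θ` where `φ̃(x)_n = ∑_{d|n} d·x_d` and `φ(x)_n = ∑_{d|n} x_d`. -/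
theorem necklace_aperiodic_iso (R : Type*) [CommRing R] [Algebra ℚ R] :
    ∃ instN instA : CommRing (ℕ+ → R),
      (∀ x y : ℕ+ → R, ∀ n : ℕ+, instN.add x y n = x n + y n) ∧
      (∀ x y : ℕ+ → R, ∀ n : ℕ+, instN.mul x y n =
        ∑ p ∈ lcmPairs (n : ℕ), (Nat.gcd p.1 p.2 : R) * seqExt x p.1 * seqExt y p.2) ∧
      (∀ x y : ℕ+ → R, ∀ n : ℕ+, instA.add x y n = x n + y n) ∧
      (∀ x y : ℕ+ → R, ∀ n : ℕ+, instA.mul x y n =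
        ∑ p ∈ lcmPairs (n : ℕ), seqExt x p.1 * seqExt y p.2) ∧
      ∃ θ : (ℕ+ → R) ≃ (ℕ+ → R),
        (∀ x : ℕ+ → R, ∀ n : ℕ+, θ x n = ((n : ℕ) : R) * x n) ∧
        (∀ x y : ℕ+ → R, θ (instN.mul x y) = instA.mul (θ x) (θ y)) ∧
        (∀ x y : ℕ+ → R, θ (instN.add x y) = instA.add (θ x) (θ y)) ∧
        (∀ x : ℕ+ → R, ∀ n : ℕ+,
          ∑ d ∈ (n : ℕ).divisors, (d : R) * seqExt x d
            = ∑ d ∈ (n : ℕ).divisors, seqExt (θ x) d) := by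
  let φ := divisorSumEquiv R
  let θ := indexScaleEquiv R
  have addA (x y : ℕ+ → R) : φ.symm (φ x + φ y) = x + y := by
    rw [Equiv.symm_apply_eq, divisorSumEquiv_add]
  have mulA (x y : ℕ+ → R) : φ.symm (φ x * φ y)
      = fun n : ℕ+ => ∑ p ∈ lcmPairs (n : ℕ), seqExt x p.1 * seqExt y p.2 := by
    rw [Equiv.symm_apply_eq, divisorSumEquiv_mul]
  have addN (x y : ℕ+ → R) : (θ.trans φ).symm (θ.trans φ x + θ.trans φ y) = x + y := by
    rw [Equiv.symm_apply_eq, Equiv.trans_apply, Equiv.trans_apply, Equiv.trans_apply,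
      indexScaleEquiv_add, divisorSumEquiv_add]
  have mulN (x y : ℕ+ → R) : (θ.trans φ).symm (θ.trans φ x * θ.trans φ y)
      = fun n : ℕ+ => ∑ p ∈ lcmPairs (n : ℕ),
        (Nat.gcd p.1 p.2 : R) * seqExt x p.1 * seqExt y p.2 := by
    rw [Equiv.symm_apply_eq, Equiv.trans_apply, Equiv.trans_apply, Equiv.trans_apply,
      indexScaleEquiv_mul, divisorSumEquiv_mul]
  refine ⟨(θ.trans φ).commRing, φ.commRing, fun x y n => congrFun (addN x y) n,
    fun x y n => congrFun (mulN x y) n, fun x y n => congrFun (addA x y) n,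
    fun x y n => congrFun (mulA x y) n, θ, fun _ _ => rfl, fun x y => ?_, fun x y => ?_,
    fun x n => Finset.sum_congr rfl fun d _ => (seqExt_indexScaleEquiv x d).symm⟩
  · exact (congrArg θ (mulN x y)).trans ((indexScaleEquiv_mul x y).trans (mulA _ _).symm)
  · exact (congrArg θ (addN x y)).trans ((indexScaleEquiv_add x y).trans (addA _ _).symm)
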